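/- Let λ₁, λ₂ ∈ ℝ, Ξ = {(ξ,η) ∈ ℝ² : 0 ≤ ξ ≤ 2, 0 ≤ η ≤ min(ξ, 2−ξ)}, and let M > 0 satisfy M ≥ (3/4) max(|λ₁|, |λ₂|). Suppose G, H : Ξ → ℝ are continuous and satisfy |G(ξ,η)| ≤ M^{n+1} (ξ+η)^n / n! and |H(ξ,η)| ≤ M^{n+1} (ξ+η)^n / n! for all (ξ,η) ∈ Ξ, for some n ≥ 0. Define G'(ξ,η) = (λ₂/2) ∫₀^η ∫₀^τ H(τ,s) ds dτ + (λ₂/4) ∫_η^ξ ∫₀^η H(τ,s) ds dτ and H'(ξ,η) = (λ₁/2) ∫₀^η ∫₀^τ G(τ,s) ds dτ + (λ₁/4) ∫_η^ξ ∫₀^η G(τ,s) ds dτ. Then |G'(ξ,η)| ≤ M^{n+2} (ξ+η)^{n+1} / (n+1)! and |H'(ξ,η)| ≤ M^{n+2} (ξ+η)^{n+1} / (n+1)! for all (ξ,η) ∈ Ξ. -/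

import Mathlib

open MeasureTheory Set

/-- The characteristic-coordinate domain `Ξ = {(ξ,η) : 0 ≤ ξ ≤ 2, 0 ≤ η ≤ min(ξ, 2−ξ)}`. -/
def XiDom : Set (ℝ × ℝ) :=
  {p : ℝ × ℝ | 0 ≤ p.1 ∧ p.1 ≤ 2 ∧ 0 ≤ p.2 ∧ p.2 ≤ min p.1 (2 - p.1)}

/-- Bound for one component of the integral operator: only the kernel bound on `Ξ` is used. -/
lemma abs_integralOperator_le (l M : ℝ) (n : ℕ) (hM : 0 < M) (hl : |l| ≤ 4 * M)
    (H : ℝ → ℝ → ℝ)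
    (hH : ∀ p ∈ XiDom, |H p.1 p.2| ≤ M ^ (n + 1) * (p.1 + p.2) ^ n / n.factorial)
    (ξ η : ℝ) (hp : (ξ, η) ∈ XiDom) :
    |(l / 2) * (∫ τ in (0:ℝ)..η, ∫ s in (0:ℝ)..τ, H τ s) +
        (l / 4) * ∫ τ in η..ξ, ∫ s in (0:ℝ)..η, H τ s| ≤
      M ^ (n + 2) * (ξ + η) ^ (n + 1) / (n + 1).factorial := by
  obtain ⟨hξ, hξ2, hη, hmin⟩ := hp
  obtain ⟨hηξ, hη2⟩ := le_min_iff.mp hmin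
  dsimp only at hξ hξ2 hη hηξ hη2
  set C : ℝ := M ^ (n + 1) / n.factorial with hC
  have hC0 : 0 ≤ C := by positivity
  -- Inner integrals run over intervals of length at most one.
  have inner : ∀ τ b : ℝ, 0 ≤ b → b ≤ 1 → b ≤ τ → b ≤ 2 - τ →
      ‖∫ s in (0:ℝ)..b, H τ s‖ ≤ C * (τ + b) ^ n := by
    intro τ b hb hb1 hbτ hbτ2
    have h := intervalIntegral.norm_integral_le_of_norm_le_const
      (a := 0) (b := b) (f := H τ) (C := C * (τ + b) ^ n) (by
        intro s hs
        rw [uIoc_of_le hb] at hs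
        have hs0 : 0 ≤ s := hs.1.le
        have hsb : s ≤ b := hs.2
        have hmem : (τ, s) ∈ XiDom :=
          ⟨by dsimp; linarith, by dsimp; linarith, hs0, le_min (by dsimp; linarith)
            (by dsimp; linarith)⟩
        calc ‖H τ s‖ ≤ M ^ (n + 1) * (τ + s) ^ n / n.factorial := hH _ hmem
          _ = C * (τ + s) ^ n := by rw [hC]; ring
          _ ≤ C * (τ + b) ^ n := by
            have : 0 ≤ τ + s := by linarith
            gcongr)
    rw [sub_zero, abs_of_nonneg hb] at h
    have hτb : 0 ≤ C * (τ + b) ^ n := mul_nonneg hC0 (pow_nonneg (by linarith) _)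
    exact h.trans (mul_le_of_le_one_right hτb hb1)
  have h1 : |∫ τ in (0:ℝ)..η, ∫ s in (0:ℝ)..τ, H τ s| ≤
      C * ((2 * η) ^ (n + 1) / (2 * (n + 1))) := by
    have h := intervalIntegral.norm_integral_le_of_norm_le (μ := volume) hη
      (f := fun τ => ∫ s in (0:ℝ)..τ, H τ s) (g := fun τ => C * (2 * τ) ^ n)
      (Filter.Eventually.of_forall fun τ hτ => by
        simpa only [two_mul] using inner τ τ hτ.1.le (by linarith [hτ.2]) le_rfl
          (by linarith [hτ.2]))
      (Continuous.intervalIntegrable (by fun_prop) _ _)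
    refine h.trans_eq ?_
    simp only [mul_pow, intervalIntegral.integral_const_mul, integral_pow]
    field_simp
    ring
  have h2 : |∫ τ in η..ξ, ∫ s in (0:ℝ)..η, H τ s| ≤
      C * (((ξ + η) ^ (n + 1) - (2 * η) ^ (n + 1)) / (n + 1)) := by
    have h := intervalIntegral.norm_integral_le_of_norm_le (μ := volume) hηξ
      (f := fun τ => ∫ s in (0:ℝ)..η, H τ s) (g := fun τ => C * (τ + η) ^ n)
      (Filter.Eventually.of_forall fun τ hτ =>
        inner τ η hη (by linarith) hτ.1.le (by linarith [hτ.2]))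
      (Continuous.intervalIntegrable (by fun_prop) _ _)
    refine h.trans_eq ?_
    rw [intervalIntegral.integral_const_mul,
      intervalIntegral.integral_comp_add_right (fun x => x ^ n), integral_pow, two_mul]
  calc _ ≤ |l| / 2 * |∫ τ in (0:ℝ)..η, ∫ s in (0:ℝ)..τ, H τ s| +
        |l| / 4 * |∫ τ in η..ξ, ∫ s in (0:ℝ)..η, H τ s| := by
        refine (abs_add_le _ _).trans_eq ?_
        simp [abs_mul, abs_div]
    _ ≤ |l| / 2 * (C * ((2 * η) ^ (n + 1) / (2 * (n + 1)))) +
        |l| / 4 * (C * (((ξ + η) ^ (n + 1) - (2 * η) ^ (n + 1)) / (n + 1))) := by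
        gcongr
    _ = |l| / 4 * (C * (ξ + η) ^ (n + 1) / (n + 1)) := by
        field_simp
        ring
    _ ≤ M * (C * (ξ + η) ^ (n + 1) / (n + 1)) := by
        gcongr
        linarith
    _ = M ^ (n + 2) * (ξ + η) ^ (n + 1) / (n + 1).factorial := by
        rw [hC, Nat.factorial_succ]
        push_cast
        field_simp
        ring

/-- inductive bound for the successive-approximation iteration of the kernel
integral equations: if `|G|, |H| ≤ M^{n+1}(ξ+η)^n/n!` on `Ξ` and `M ≥ (3/4)max(|λ₁|,|λ₂|)`,
then the images `G' = Ω₁[H]`, `H' = Ω₂[G]` satisfy `|G'|, |H'| ≤ M^{n+2}(ξ+η)^{n+1}/(n+1)!`. -/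
theorem successive_approximation_inductive_bound
    (l1 l2 M : ℝ) (n : ℕ)
    (hM : 0 < M) (hMl : (3 / 4) * max |l1| |l2| ≤ M)
    (G H : ℝ → ℝ → ℝ)
    (hGcont : ContinuousOn (fun p : ℝ × ℝ => G p.1 p.2) XiDom)
    (hHcont : ContinuousOn (fun p : ℝ × ℝ => H p.1 p.2) XiDom)
    (hGbd : ∀ p ∈ XiDom, |G p.1 p.2| ≤ M ^ (n + 1) * (p.1 + p.2) ^ n / n.factorial)
    (hHbd : ∀ p ∈ XiDom, |H p.1 p.2| ≤ M ^ (n + 1) * (p.1 + p.2) ^ n / n.factorial)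
    (G' H' : ℝ → ℝ → ℝ)
    (hG' : G' = fun ξ η =>
      (l2 / 2) * (∫ τ in (0:ℝ)..η, ∫ s in (0:ℝ)..τ, H τ s) +
        (l2 / 4) * ∫ τ in η..ξ, ∫ s in (0:ℝ)..η, H τ s)
    (hH' : H' = fun ξ η =>
      (l1 / 2) * (∫ τ in (0:ℝ)..η, ∫ s in (0:ℝ)..τ, G τ s) +
        (l1 / 4) * ∫ τ in η..ξ, ∫ s in (0:ℝ)..η, G τ s) :
    ∀ p ∈ XiDom,
      |G' p.1 p.2| ≤ M ^ (n + 2) * (p.1 + p.2) ^ (n + 1) / (n + 1).factorial ∧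
      |H' p.1 p.2| ≤ M ^ (n + 2) * (p.1 + p.2) ^ (n + 1) / (n + 1).factorial := by
  rintro ⟨ξ, η⟩ hp
  have hl1 : |l1| ≤ 4 * M := by linarith [le_max_left |l1| |l2|]
  have hl2 : |l2| ≤ 4 * M := by linarith [le_max_right |l1| |l2|]
  subst hG' hH'
  exact ⟨abs_integralOperator_le l2 M n hM hl2 H hHbd ξ η hp,
    abs_integralOperator_le l1 M n hM hl1 G hGbd ξ η hp⟩
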